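/- For all i ∈ {1,…,n−1}, j ∈ {1,…,n} with j ≠ i and j ≠ i+1, and ε ∈ {1,−1}, the identity gᵢ 𝒯ⱼ^ε = 𝒯ⱼ^ε gᵢ holds in H_{2,n}(q). (Lemma 2, item (2), 𝒯-version.) -/

import Mathlib

noncomputable section

namespace MixedHecke

/-- The ring `ℤ[q,q⁻¹]` of Laurent polynomials over `ℤ`. -/
abbrev R : Type := LaurentPolynomial ℤ

/-- The variable `q`. -/
def q : R := LaurentPolynomial.T 1

/-- The inverse `q⁻¹` of the variable `q`. -/
def qinv : R := LaurentPolynomial.T (-1)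

/-- Generators of the mixed braid group `B_{2,n}`:
`Sum.inl true` is `𝒯`, `Sum.inl false` is `τ`, and `Sum.inr ⟨i, _⟩` is `σ_i` for `1 ≤ i ≤ n-1`. -/
def Gen (n : ℕ) : Type := Bool ⊕ {i : ℕ // 1 ≤ i ∧ i < n}

/-- The generator `𝒯` in the free group. -/
def fT (n : ℕ) : FreeGroup (Gen n) := FreeGroup.of (Sum.inl true)

/-- The generator `τ` in the free group. -/
def ftau (n : ℕ) : FreeGroup (Gen n) := FreeGroup.of (Sum.inl false)

/-- The generator `σ_i` in the free group (junk value `1` for `i` out of range). -/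
def fs (n i : ℕ) : FreeGroup (Gen n) :=
  if h : 1 ≤ i ∧ i < n then FreeGroup.of (Sum.inr ⟨i, h⟩) else 1

/-- The defining relators of the mixed braid group `B_{2,n}`. -/
def rels (n : ℕ) : Set (FreeGroup (Gen n)) :=
  { x | (∃ k j, 1 ≤ j ∧ j + 1 < k ∧ k < n ∧
          x = fs n k * fs n j * (fs n j * fs n k)⁻¹) ∨
        (∃ k, 1 ≤ k ∧ k + 1 < n ∧
          x = fs n k * fs n (k+1) * fs n k * (fs n (k+1) * fs n k * fs n (k+1))⁻¹) ∨
        (∃ k, 2 ≤ k ∧ k < n ∧ x = fT n * fs n k * (fs n k * fT n)⁻¹) ∨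
        (∃ k, 2 ≤ k ∧ k < n ∧ x = ftau n * fs n k * (fs n k * ftau n)⁻¹) ∨
        (1 < n ∧ x = fT n * fs n 1 * fT n * fs n 1 * (fs n 1 * fT n * fs n 1 * fT n)⁻¹) ∨
        (1 < n ∧ x = ftau n * fs n 1 * ftau n * fs n 1 * (fs n 1 * ftau n * fs n 1 * ftau n)⁻¹) ∨
        (1 < n ∧ x = ftau n * (fs n 1 * fT n * fs n 1) * ((fs n 1 * fT n * fs n 1) * ftau n)⁻¹) }

/-- The mixed braid group `B_{2,n}` on two fixed strands. -/
abbrev B (n : ℕ) : Type := PresentedGroup (rels n)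

/-- The group algebra `ℤ[q,q⁻¹] B_{2,n}`. -/
abbrev GA (n : ℕ) : Type := MonoidAlgebra R (B n)

/-- The image of `σ_i` in the group algebra. -/
def gA (n i : ℕ) : GA n := MonoidAlgebra.of R (B n) (PresentedGroup.mk (rels n) (fs n i))

/-- The quadratic relations `σ_i² = (q-1)σ_i + q·1`, `i = 1, …, n-1`. -/
inductive quadRel (n : ℕ) : GA n → GA n → Prop
  | intro (i : ℕ) (h1 : 1 ≤ i) (h2 : i < n) :
      quadRel n (gA n i * gA n i) ((q - 1) • gA n i + q • (1 : GA n))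

/-- The mixed Hecke algebra `H_{2,n}(q)`: the quotient of the group algebra `ℤ[q,q⁻¹] B_{2,n}`
by the two-sided ideal generated by the quadratic relations. -/
abbrev H (n : ℕ) : Type := RingQuot (quadRel n)

/-- The canonical monoid homomorphism `B_{2,n} →* H_{2,n}(q)`. -/
def π (n : ℕ) : B n →* H n :=
  (RingQuot.mkAlgHom R (quadRel n)).toMonoidHom.comp (MonoidAlgebra.of R (B n))

/-- The canonical map from the free group on the generators to the units of `H_{2,n}(q)`
(images of group elements are units). -/
def U (n : ℕ) : FreeGroup (Gen n) →* (H n)ˣ :=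
  ((π n).comp (PresentedGroup.mk (rels n))).toHomUnits

/-- The braiding generator `g_i` as a unit of `H_{2,n}(q)`. -/
def g (n i : ℕ) : (H n)ˣ := U n (fs n i)

/-- The word for the looping element `𝒯_i` : `𝒯_1 = 𝒯` and `𝒯_{i+1} = σ_i 𝒯_i σ_i`,
i.e. `𝒯_i = σ_{i-1} ⋯ σ_1 𝒯 σ_1 ⋯ σ_{i-1}`. -/
def wT (n : ℕ) : ℕ → FreeGroup (Gen n)
  | 0 => 1
  | 1 => fT n
  | (i+2) => fs n (i+1) * wT n (i+1) * fs n (i+1)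

/-- The word for the looping element `τ_i` : `τ_1 = τ` and `τ_{i+1} = σ_i τ_i σ_i`,
i.e. `τ_i = σ_{i-1} ⋯ σ_1 τ σ_1 ⋯ σ_{i-1}`. -/
def wtau (n : ℕ) : ℕ → FreeGroup (Gen n)
  | 0 => 1
  | 1 => ftau n
  | (i+2) => fs n (i+1) * wtau n (i+1) * fs n (i+1)

/-- The looping element `𝒯_i` as a unit of `H_{2,n}(q)`. -/
def T (n i : ℕ) : (H n)ˣ := U n (wT n i)

/-- The looping element `τ_i` as a unit of `H_{2,n}(q)`. -/
def tau (n i : ℕ) : (H n)ˣ := U n (wtau n i)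

/-- The loopings of index `i` : `𝒯_i, τ_i, 𝒯_i⁻¹, τ_i⁻¹`, as units of `H_{2,n}(q)`. -/
def LoopU (n i : ℕ) : Set (H n)ˣ := {T n i, tau n i, (T n i)⁻¹, (tau n i)⁻¹}

/-- The braiding generators `g_i`, `1 ≤ i ≤ n-1`, as elements of `H_{2,n}(q)`. -/
def BraidGens (n : ℕ) : Set (H n) := {x | ∃ i, 1 ≤ i ∧ i < n ∧ x = (g n i : H n)}

/-- The elements `g_i^{±1}` with `lo ≤ i ≤ hi - 1`, as elements of `H_{2,n}(q)`. -/
def BraidPM (n lo hi : ℕ) : Set (H n) :=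
  {x | ∃ i, lo ≤ i ∧ i < hi ∧ (x = (g n i : H n) ∨ x = ((g n i)⁻¹ : (H n)ˣ))}


/-- The canonical map identifies the two sides of a defining relation of `B_{2,n}`. -/
theorem U_eq_of_mem_rels {n : ℕ} {a b : FreeGroup (Gen n)} (h : a * b⁻¹ ∈ rels n) :
    U n a = U n b := by
  have h1 : PresentedGroup.mk (rels n) a = PresentedGroup.mk (rels n) b := by
    rw [← mul_inv_eq_one, ← map_inv, ← map_mul]
    exact PresentedGroup.one_of_mem h
  apply Units.ext
  simp only [U, MonoidHom.coe_toHomUnits, MonoidHom.comp_apply, h1]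

theorem g_commute {n k j : ℕ} (hj : 1 ≤ j) (hjk : j + 1 < k) (hk : k < n) :
    Commute (g n k) (g n j) := by
  have h := U_eq_of_mem_rels (n := n) (a := fs n k * fs n j) (b := fs n j * fs n k)
    (Or.inl ⟨k, j, hj, hjk, hk, rfl⟩)
  simp only [map_mul] at h
  exact h

theorem g_braid {n k : ℕ} (hk : 1 ≤ k) (hkn : k + 1 < n) :
    g n k * g n (k + 1) * g n k = g n (k + 1) * g n k * g n (k + 1) := by
  have h := U_eq_of_mem_rels (n := n) (a := fs n k * fs n (k + 1) * fs n k)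
    (b := fs n (k + 1) * fs n k * fs n (k + 1)) (Or.inr (Or.inl ⟨k, hk, hkn, rfl⟩))
  simp only [map_mul] at h
  exact h

theorem T_one_commute_g {n k : ℕ} (hk : 2 ≤ k) (hkn : k < n) : Commute (T n 1) (g n k) := by
  have h := U_eq_of_mem_rels (n := n) (a := fT n * fs n k) (b := fs n k * fT n)
    (Or.inr (Or.inr (Or.inl ⟨k, hk, hkn, rfl⟩)))
  simp only [map_mul] at h
  exact h

theorem T_succ (n : ℕ) {j : ℕ} (hj : 1 ≤ j) : T n (j + 1) = g n j * T n j * g n j := by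
  obtain ⟨i, rfl⟩ := Nat.exists_eq_add_of_le' hj
  simp only [T, g, wT, map_mul]

theorem g_commute_T_of_lt {n i j : ℕ} (hj : 1 ≤ j) (hji : j < i) (hi : i < n) :
    Commute (g n i) (T n j) := by
  induction j, hj using Nat.le_induction with
  | base => exact (T_one_commute_g hji hi).symm
  | succ j hj ih =>
    rw [T_succ n hj]
    have hg := g_commute hj hji hi
    exact (hg.mul_right (ih (by lia))).mul_right hg

theorem g_commute_T_add_two {n i : ℕ} (hi : 1 ≤ i) (hin : i + 1 < n) :
    Commute (g n i) (T n (i + 2)) := by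
  rw [T_succ n (by lia : 1 ≤ i + 1), T_succ n hi]
  have hb := g_braid hi hin
  have hT := g_commute_T_of_lt hi (Nat.lt_succ_self i) hin
  generalize g n (i + 1) = b at *
  generalize g n i = a at *
  generalize T n i = t at *
  calc a * (b * (a * t * a) * b) = a * b * a * (t * a * b) := by group
    _ = b * a * (b * t) * (a * b) := by rw [hb]; group
    _ = b * a * t * (b * a * b) := by rw [hT.eq]; group
    _ = b * (a * t * a) * b * a := by rw [← hb]; group

theorem g_commute_T_of_add_two_le {n i j : ℕ} (hi : 1 ≤ i) (hij : i + 2 ≤ j) (hj : j ≤ n) :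
    Commute (g n i) (T n j) := by
  induction j, hij using Nat.le_induction with
  | base => exact g_commute_T_add_two hi hj
  | succ j hij ih =>
    rw [T_succ n (by lia)]
    have hg := (g_commute hi hij hj).symm
    exact (hg.mul_right (ih (by lia))).mul_right hg

/-- **Lemma 2, item (2), `𝒯`-version.** `g_i 𝒯_j^ε = 𝒯_j^ε g_i` for `j ≠ i, i+1`. -/
theorem lemma2_item2_T (n : ℕ) (hn : 1 ≤ n) (i j : ℕ) (hi1 : 1 ≤ i) (hi2 : i < n)
    (hj1 : 1 ≤ j) (hj2 : j ≤ n) (hji : j ≠ i) (hji' : j ≠ i + 1)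
    (ε : ℤ) (hε : ε = 1 ∨ ε = -1) :
    (g n i : H n) * ((T n j ^ ε : (H n)ˣ) : H n)
      = ((T n j ^ ε : (H n)ˣ) : H n) * (g n i : H n) := by
  have h : Commute (g n i) (T n j) := by
    rcases lt_or_gt_of_ne hji with h | h
    · exact g_commute_T_of_lt hj1 h hi2
    · exact g_commute_T_of_add_two_le hi1 (by lia) hj2
  exact congrArg Units.val (h.zpow_right ε).eq

end MixedHecke
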